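/- The graph H'' itself admits no good coloring. -/

import Mathlib

/-- A 2-coloring of the vertices is encoded by `red : V → Prop`;
`red v` means `v` is colored red, otherwise `v` is blue.
A *good coloring* requires:
(1) the subgraph induced by blue vertices has maximum degree at most 1,
(2) the subgraph induced by red vertices has minimum degree at least 1,
(3) the subgraph induced by red vertices contains no path on 4 vertices. -/
def IsGoodColoring {V : Type*} (G : SimpleGraph V) (red : V → Prop) : Prop :=
  (∀ v w₁ w₂ : V, ¬ red v → ¬ red w₁ → ¬ red w₂ →
      G.Adj v w₁ → G.Adj v w₂ → w₁ = w₂) ∧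
  (∀ v : V, red v → ∃ w : V, red w ∧ G.Adj v w) ∧
  (∀ a b c d : V, red a → red b → red c → red d →
      a ≠ c → a ≠ d → b ≠ d →
      ¬ (G.Adj a b ∧ G.Adj b c ∧ G.Adj c d))

/-- A graph is subcubic if every vertex has degree at most 3. -/
def Subcubic {V : Type*} (G : SimpleGraph V) : Prop :=
  ∀ v : V, (G.neighborSet v).encard ≤ 3

/-- Adjacency in the graph `H`: the 8-cycle `v₀v₁…v₇v₀` together with the
two chords `v₂v₆` and `v₃v₇`. -/
def HAdj (i j : Fin 8) : Prop :=
  (j = i + 1 ∨ i = j + 1) ∨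
  (i = 2 ∧ j = 6) ∨ (i = 6 ∧ j = 2) ∨ (i = 3 ∧ j = 7) ∨ (i = 7 ∧ j = 3)

/-- Adjacency in the graph `H'`: two disjoint copies of `H` (copy `0` on the
`vᵢ`'s and copy `1` on the `uᵢ`'s), together with the joining edges
`v₄u₀` and `v₅u₁`.  Vertex `(c, i)` is vertex `i` of copy `c`. -/
def H'Adj (p q : Fin 2 × Fin 8) : Prop :=
  (p.1 = q.1 ∧ HAdj p.2 q.2) ∨
  (p = (0, 4) ∧ q = (1, 0)) ∨ (p = (1, 0) ∧ q = (0, 4)) ∨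
  (p = (0, 5) ∧ q = (1, 1)) ∨ (p = (1, 1) ∧ q = (0, 5))

/-- Adjacency in the graph `H''`: three disjoint copies of `H'` (indexed by
`Fin 3`) together with the three joining edges connecting the distinguished
vertex `v₁ = (0,1)` of copy `i` to the distinguished vertex `v₀ = (0,0)` of
copy `i+1`, so that the six distinguished vertices form a 6-cycle meeting
all three copies of `H'`. -/
def H''Adj (p q : Fin 3 × Fin 2 × Fin 8) : Prop :=
  (p.1 = q.1 ∧ H'Adj p.2 q.2) ∨
  (p.2 = (0, 1) ∧ q.2 = (0, 0) ∧ q.1 = p.1 + 1) ∨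
  (p.2 = (0, 0) ∧ q.2 = (0, 1) ∧ p.1 = q.1 + 1)

/-- The graph `H''` (as a simple graph on its 48 vertices; note `H''Adj` is
already symmetric and irreflexive, so `SimpleGraph.fromRel H''Adj` has
exactly the edges of `H''`). -/
def GraphH'' : SimpleGraph (Fin 3 × Fin 2 × Fin 8) :=
  SimpleGraph.fromRel H''Adj

instance : DecidableRel HAdj := fun _ _ => by unfold HAdj; infer_instance

instance : DecidableRel H'Adj := fun _ _ => by unfold H'Adj; infer_instance

instance : DecidableRel H''Adj := fun _ _ => by unfold H''Adj; infer_instance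

instance : DecidableRel GraphH''.Adj := fun p q =>
  decidable_of_iff (p ≠ q ∧ (H''Adj p q ∨ H''Adj q p)) (SimpleGraph.fromRel_adj _ p q).symm

/-- The conditions which a good coloring of `H''` induces on a copy of `H`, where the vertices
`0`, `1`, `4` and `5` may have a further neighbor outside the copy. -/
structure IsGoodInside (r : Fin 8 → Prop) : Prop where
  blue : ∀ i j k, HAdj i j ∧ HAdj i k ∧ j ≠ k → r i ∨ r j ∨ r k
  red : ∀ i, i = 2 ∨ i = 3 ∨ i = 6 ∨ i = 7 → r i → ∃ j, HAdj i j ∧ r j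
  path : ∀ i j k l, HAdj i j ∧ HAdj j k ∧ HAdj k l ∧ i ≠ k ∧ i ≠ l ∧ j ≠ l →
    ¬ (r i ∧ r j ∧ r k ∧ r l)

namespace IsGoodInside

variable {r : Fin 8 → Prop}

/-- The reflection of `H` exchanging the vertices `0` and `1` preserves `IsGoodInside`. -/
theorem reflect (h : IsGoodInside r) : IsGoodInside fun i => r (1 - i) := by
  have adj : ∀ i j, HAdj i j → HAdj (1 - i) (1 - j) := by decide
  refine ⟨fun i j k hijk => h.blue _ _ _ ⟨adj _ _ hijk.1, adj _ _ hijk.2.1, by simp [hijk.2.2]⟩,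
    fun i hi hr => ?_, fun i j k l ⟨hij, hjk, hkl, hik, hil, hjl⟩ => h.path _ _ _ _
      ⟨adj _ _ hij, adj _ _ hjk, adj _ _ hkl, by simp [hik], by simp [hil], by simp [hjl]⟩⟩
  obtain ⟨j, hj, hrj⟩ := h.red (1 - i) (by clear hr; revert i; decide) hr
  exact ⟨1 - j, by simpa using adj _ _ hj, by simpa using hrj⟩

theorem red_two (h : IsGoodInside r) (h2 : r 2) : r 1 ∨ r 3 ∨ r 6 := by
  obtain ⟨j, hj, hr⟩ := h.red 2 (by decide) h2
  have : ∀ j, HAdj 2 j → j = 1 ∨ j = 3 ∨ j = 6 := by decide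
  rcases this j hj with rfl | rfl | rfl <;> simp [hr]

theorem red_three (h : IsGoodInside r) (h3 : r 3) : r 2 ∨ r 4 ∨ r 7 := by
  obtain ⟨j, hj, hr⟩ := h.red 3 (by decide) h3
  have : ∀ j, HAdj 3 j → j = 2 ∨ j = 4 ∨ j = 7 := by decide
  rcases this j hj with rfl | rfl | rfl <;> simp [hr]

theorem red_six (h : IsGoodInside r) (h6 : r 6) : r 7 ∨ r 5 ∨ r 2 :=
  h.reflect.red_three h6

/-- The vertices `0` and `1` of a copy of `H` are not both red. -/
theorem not_red_one (h : IsGoodInside r) (h0 : r 0) : ¬ r 1 := by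
  have := h.red_three
  have := h.red_six
  have := h.blue 2 3 6 (by decide)
  have := h.blue 3 2 7 (by decide)
  have := h.blue 6 7 2 (by decide)
  have := h.blue 7 6 3 (by decide)
  have := h.path 0 1 2 3 (by decide)
  have := h.path 0 1 2 6 (by decide)
  have := h.path 1 0 7 3 (by decide)
  have := h.path 1 0 7 6 (by decide)
  have := h.path 2 1 0 7 (by decide)
  have := h.path 3 4 5 6 (by decide)
  grind

theorem not_red_seven (h : IsGoodInside r) (h45 : r 4 ∨ r 5) (h0 : r 0) : ¬ r 7 := by
  have := h.red_two
  have := h.blue 2 1 3 (by decide)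
  have := h.blue 2 1 6 (by decide)
  have := h.blue 2 3 6 (by decide)
  have := h.path 0 7 3 2 (by decide)
  have := h.path 0 7 3 4 (by decide)
  have := h.path 0 7 6 2 (by decide)
  have := h.path 1 0 7 3 (by decide)
  have := h.path 1 0 7 6 (by decide)
  have := h.path 2 1 0 7 (by decide)
  have := h.path 3 7 6 5 (by decide)
  grind

theorem not_red_two (h : IsGoodInside r) (h45 : r 4 ∨ r 5) (h1 : r 1) : ¬ r 2 :=
  h.reflect.not_red_seven h45.symm h1

end IsGoodInside

namespace IsGoodColoring

variable {red : Fin 3 × Fin 2 × Fin 8 → Prop}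

theorem isGoodInside (h : IsGoodColoring GraphH'' red) (t : Fin 3) (c : Fin 2) :
    IsGoodInside fun i => red (t, c, i) := by
  obtain ⟨hb, hr, hp⟩ := h
  have adj : ∀ t c i j, HAdj i j → GraphH''.Adj (t, c, i) (t, c, j) := by decide +kernel
  refine ⟨fun i j k ⟨hij, hik, hjk⟩ => ?_, fun i hi' hi => ?_,
    fun i j k l ⟨hij, hjk, hkl, hik, hil, hjl⟩ ⟨hi, hj, hk, hl⟩ =>
      hp _ _ _ _ hi hj hk hl (by simp [hik]) (by simp [hil]) (by simp [hjl])
        ⟨adj t c i j hij, adj t c j k hjk, adj t c k l hkl⟩⟩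
  · by_contra! hc
    exact hjk (by simpa using hb _ _ _ hc.1 hc.2.1 hc.2.2 (adj t c i j hij) (adj t c i k hik))
  · obtain ⟨⟨t', c', j⟩, hw, ha⟩ := hr _ hi
    have inside : ∀ i, i = 2 ∨ i = 3 ∨ i = 6 ∨ i = 7 → ∀ t c t' c' j,
        GraphH''.Adj (t, c, i) (t', c', j) → t' = t ∧ c' = c ∧ HAdj i j := by decide +kernel
    obtain ⟨rfl, rfl, hij⟩ := inside i hi' _ _ _ _ _ ha
    exact ⟨j, hij, hw⟩

/-- The vertices `v₄` and `v₅` of a copy of `H'` are not both blue, since otherwise the vertices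
`u₀` and `u₁` would both be red. -/
theorem red_four_or_five (h : IsGoodColoring GraphH'' red) (t : Fin 3) :
    red (t, 0, 4) ∨ red (t, 0, 5) := by
  by_contra! hc
  have adj : ∀ t : Fin 3, GraphH''.Adj (t, 0, 4) (t, 0, 5) ∧ GraphH''.Adj (t, 0, 4) (t, 1, 0) ∧
    GraphH''.Adj (t, 0, 5) (t, 1, 1) := by decide +kernel
  obtain ⟨h45, h4, h5⟩ := adj t
  have h0 : red (t, 1, 0) := by
    by_contra h0
    simpa using h.1 _ _ _ hc.1 hc.2 h0 h45 h4
  have h1 : red (t, 1, 1) := by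
    by_contra h1
    simpa using h.1 _ _ _ hc.2 hc.1 h1 h45.symm h5
  exact (h.isGoodInside t 1).not_red_one h0 h1

/-- If the vertex `v₀` of a copy of `H'` is blue, then the vertex `v₀` of the next copy is red:
the edge between the copies either joins `v₁` to its only possible red neighbor, or it starts at
the blue edge `v₀v₁`. -/
theorem red_zero_succ (h : IsGoodColoring GraphH'' red) (t : Fin 3) (h0 : ¬ red (t, 0, 0)) :
    red (t + 1, 0, 0) := by
  by_cases h1 : red (t, 0, 1)
  · have h2 := (h.isGoodInside t 0).not_red_two (h.red_four_or_five t) h1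
    have nbr : ∀ (t : Fin 3) w, GraphH''.Adj (t, 0, 1) w →
        w = (t, 0, 0) ∨ w = (t, 0, 2) ∨ w = (t + 1, 0, 0) := by decide +kernel
    obtain ⟨w, hw, ha⟩ := h.2.1 _ h1
    rcases nbr t w ha with rfl | rfl | rfl
    exacts [absurd hw h0, absurd hw h2, hw]
  · have adj : ∀ t : Fin 3, GraphH''.Adj (t, 0, 1) (t, 0, 0) ∧
      GraphH''.Adj (t, 0, 1) (t + 1, 0, 0) := by decide +kernel
    by_contra hc
    simpa using h.1 _ _ _ h1 h0 hc (adj t).1 (adj t).2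

/-- If the vertex `v₁` of a copy of `H'` is blue, then the vertex `v₁` of the preceding copy is
red. -/
theorem red_one_of_succ (h : IsGoodColoring GraphH'' red) (t : Fin 3)
    (h1 : ¬ red (t + 1, 0, 1)) : red (t, 0, 1) := by
  by_cases h0 : red (t + 1, 0, 0)
  · have h7 := (h.isGoodInside (t + 1) 0).not_red_seven (h.red_four_or_five (t + 1)) h0
    have nbr : ∀ (t : Fin 3) w, GraphH''.Adj (t + 1, 0, 0) w →
        w = (t + 1, 0, 1) ∨ w = (t + 1, 0, 7) ∨ w = (t, 0, 1) := by decide +kernel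
    obtain ⟨w, hw, ha⟩ := h.2.1 _ h0
    rcases nbr t w ha with rfl | rfl | rfl
    exacts [absurd hw h1, absurd hw h7, hw]
  · have adj : ∀ t : Fin 3, GraphH''.Adj (t + 1, 0, 0) (t + 1, 0, 1) ∧
      GraphH''.Adj (t + 1, 0, 0) (t, 0, 1) := by decide +kernel
    by_contra hc
    simpa using h.1 _ _ _ h0 h1 hc (adj t).1 (adj t).2

/-- The color of `v₁` alternates along consecutive copies of `H'`. -/
theorem red_one_iff_not_succ (h : IsGoodColoring GraphH'' red) (t : Fin 3) :
    red (t, 0, 1) ↔ ¬ red (t + 1, 0, 1) :=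
  ⟨fun h1 => (h.isGoodInside (t + 1) 0).not_red_one
    (h.red_zero_succ t fun h0 => (h.isGoodInside t 0).not_red_one h0 h1), h.red_one_of_succ t⟩

end IsGoodColoring

/-- The graph `H''` itself admits no good coloring. -/
theorem H''_no_good_coloring :
    ¬ ∃ red : Fin 3 × Fin 2 × Fin 8 → Prop, IsGoodColoring GraphH'' red := by
  rintro ⟨red, h⟩
  have h0 : red (0, 0, 1) ↔ ¬ red (1, 0, 1) := h.red_one_iff_not_succ 0
  have h1 : red (1, 0, 1) ↔ ¬ red (2, 0, 1) := h.red_one_iff_not_succ 1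
  have h2 : red (2, 0, 1) ↔ ¬ red (0, 0, 1) := h.red_one_iff_not_succ 2
  tauto
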